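/- Let (A, m) be a quasi local ring which is finite over a central subring R, and suppose A/m is isomorphic to the full matrix ring M_{k₀}(D) over a division ring D. Then the set of maximal left ideals of A is in bijection with the projective space ℙ^{k₀−1}(D) of dimension k₀ − 1 over D, i.e. with the set of one-dimensional D-subspaces of D^{k₀}. -/

import Mathlib

/-- For a two-sided ideal `I` of `A` and a left `A`-module `M`, the submodule `I • M`
of `M` generated by the products `a • y` with `a ∈ I`, `y ∈ M`. -/
def idealSmulSpan {A : Type*} [Ring A] (I : TwoSidedIdeal A)
    (M : Type*) [AddCommGroup M] [Module A M] : Submodule A M :=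
  Submodule.span A {x : M | ∃ a ∈ I, ∃ y : M, a • y = x}

/-- A vector is monic if its first nonzero coordinate exists and equals `1`. -/
def IsMonicVec {n : ℕ} {D : Type*} [DivisionRing D] (v : Fin n → D) : Prop :=
  ∃ i, v i = 1 ∧ ∀ j < i, v j = 0

section MonicVec

variable {n : ℕ} {D : Type*} [DivisionRing D] {v w : Fin n → D}

theorem IsMonicVec.ne_zero (hv : IsMonicVec v) : v ≠ 0 := by
  rintro rfl
  obtain ⟨i, hi, -⟩ := hv
  exact zero_ne_one hi

theorem exists_first_ne_zero (hv : v ≠ 0) : ∃ i, v i ≠ 0 ∧ ∀ j < i, v j = 0 := by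
  obtain ⟨i, hi, hmin⟩ :=
    WellFounded.has_min (wellFounded_lt (α := Fin n)) {i | v i ≠ 0} (Function.ne_iff.mp hv)
  exact ⟨i, hi, fun j hj => by_contra fun h => hmin j h hj⟩

theorem exists_isMonicVec_smul (hv : v ≠ 0) : ∃ d : D, d ≠ 0 ∧ IsMonicVec (d • v) := by
  obtain ⟨i, hi, h⟩ := exists_first_ne_zero hv
  exact ⟨(v i)⁻¹, inv_ne_zero hi, i, by simp [hi], fun j hj => by simp [h j hj]⟩

theorem exists_isMonicVec_mul_right (hv : v ≠ 0) :
    ∃ d : D, d ≠ 0 ∧ IsMonicVec fun i => v i * d := by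
  obtain ⟨i, hi, h⟩ := exists_first_ne_zero hv
  exact ⟨(v i)⁻¹, inv_ne_zero hi, i, by simp [hi], fun j hj => by simp [h j hj]⟩

/-- Two monic vectors with the same set of zero coordinates have the same leading index. -/
theorem IsMonicVec.exists_common (hv : IsMonicVec v) (hw : IsMonicVec w)
    (h : ∀ i, v i = 0 ↔ w i = 0) : ∃ i, v i = 1 ∧ w i = 1 := by
  obtain ⟨i, hi, hi'⟩ := hv
  obtain ⟨j, hj, hj'⟩ := hw
  obtain hij | rfl | hij := lt_trichotomy i j
  · simp [(h i).2 (hj' i hij)] at hi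
  · exact ⟨i, hi, hj⟩
  · simp [(h j).1 (hi' j hij)] at hj

/-- Every point of the projective space has a unique monic representative. -/
theorem bijective_mk_isMonicVec : Function.Bijective
    fun v : {v : Fin n → D // IsMonicVec v} => Projectivization.mk D v.1 v.2.ne_zero := by
  constructor
  · rintro ⟨v, hv⟩ ⟨w, hw⟩ h
    obtain ⟨a, rfl⟩ := (Projectivization.mk_eq_mk_iff _ _ _ _ _).1 h
    obtain ⟨i, hi, hi'⟩ := hv.exists_common hw (by simp [Units.smul_def])
    have ha : (a : D) = 1 := by simpa [Units.smul_def, hi'] using hi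
    simp [Units.smul_def, ha]
  · intro p
    induction p with
    | h v hv =>
      obtain ⟨d, hd, hm⟩ := exists_isMonicVec_smul hv
      exact ⟨⟨d • v, hm⟩, (Projectivization.mk_eq_mk_iff' _ _ _ _ _).2 ⟨d, rfl⟩⟩

end MonicVec

namespace Matrix

variable {n : ℕ} {D : Type*} [DivisionRing D] {v w : Fin n → D}

/-- The left ideal of square matrices killing a column vector. -/
def annihilatorIdeal (v : Fin n → D) : Ideal (Matrix (Fin n) (Fin n) D) where
  carrier := {X | X *ᵥ v = 0}
  add_mem' {X Y} hX hY := by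
    simp only [Set.mem_ofPred_eq] at *
    rw [add_mulVec, hX, hY, add_zero]
  zero_mem' := zero_mulVec v
  smul_mem' Y X hX := by
    simp only [Set.mem_ofPred_eq, smul_eq_mul] at *
    rw [← mulVec_mulVec, hX, mulVec_zero]

@[simp]
theorem mem_annihilatorIdeal {X : Matrix (Fin n) (Fin n) D} :
    X ∈ annihilatorIdeal v ↔ X *ᵥ v = 0 := Iff.rfl

theorem annihilatorIdeal_ne_top (hv : v ≠ 0) : annihilatorIdeal v ≠ ⊤ := by
  rw [Ideal.ne_top_iff_one]
  simpa using hv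

theorem annihilatorIdeal_le_mul_right (v : Fin n → D) (d : D) :
    annihilatorIdeal v ≤ annihilatorIdeal fun i => v i * d := by
  intro X hX
  ext i
  have h : ∑ j, X i j * v j = 0 := congrFun hX i
  simp [mulVec, dotProduct, ← mul_assoc, ← Finset.sum_mul, h]

theorem annihilatorIdeal_mul_right (v : Fin n → D) {d : D} (hd : d ≠ 0) :
    annihilatorIdeal (fun i => v i * d) = annihilatorIdeal v := by
  refine le_antisymm ?_ (annihilatorIdeal_le_mul_right v d)
  simpa [mul_assoc, hd] using annihilatorIdeal_le_mul_right (fun i => v i * d) d⁻¹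

theorem eq_mul_right_of_annihilatorIdeal_le {i : Fin n} (hi : v i = 1)
    (h : annihilatorIdeal v ≤ annihilatorIdeal w) : w = fun j => v j * w i := by
  ext j
  have hX : single i j (1 : D) - single i i (v j) ∈ annihilatorIdeal v := by
    simp [sub_mulVec, single_mulVec, hi]
  have := congrFun (h hX) i
  simpa [sub_mulVec, single_mulVec, sub_eq_zero] using this

theorem annihilatorIdeal_eq_of_le (hv : IsMonicVec v) (hw : w ≠ 0)
    (h : annihilatorIdeal v ≤ annihilatorIdeal w) :
    annihilatorIdeal v = annihilatorIdeal w := by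
  obtain ⟨i, hi, -⟩ := hv
  have hwv := eq_mul_right_of_annihilatorIdeal_le hi h
  have hd : w i ≠ 0 := fun h0 => hw (by rw [hwv, h0]; ext; simp)
  rw [hwv, annihilatorIdeal_mul_right v hd]

theorem exists_le_annihilatorIdeal {J : Ideal (Matrix (Fin n) (Fin n) D)} (hJ : J ≠ ⊤) :
    ∃ v : Fin n → D, IsMonicVec v ∧ J ≤ annihilatorIdeal v := by
  let W : Submodule D (Fin n → D) :=
    { carrier := {r | ∀ c : Fin n → D, vecMulVec c r ∈ J}
      add_mem' := fun ha hb c => by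
        rw [vecMulVec_add]
        exact J.add_mem (ha c) (hb c)
      zero_mem' := fun c => by simp
      smul_mem' := fun d r hr c => by
        have : vecMulVec c (d • r) = vecMulVec (fun i => c i * d) r := by
          ext; simp [vecMulVec_apply, mul_assoc]
        rw [this]
        exact hr _ }
  have hW : W < ⊤ := by
    refine lt_top_iff_ne_top.2 fun hW => hJ ((Ideal.eq_top_iff_one J).2 ?_)
    have h1 : (1 : Matrix (Fin n) (Fin n) D) =
        ∑ i, vecMulVec (Pi.single i 1) (Pi.single i 1) := by
      ext j k
      simp [sum_apply, vecMulVec_apply, Pi.single_apply, one_apply]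
    rw [h1]
    exact J.sum_mem fun i _ => (hW ▸ Submodule.mem_top : (Pi.single i 1 : Fin n → D) ∈ W) _
  obtain ⟨f, hf, hWf⟩ := Submodule.exists_le_ker_of_lt_top W hW
  have hfr (r : Fin n → D) : f r = ∑ j, r j * f (Pi.single j 1) := by
    conv_lhs => rw [← Finset.univ_sum_single r]
    rw [map_sum]
    refine Finset.sum_congr rfl fun j _ => ?_
    rw [← smul_eq_mul, ← map_smul, ← Pi.single_smul', smul_eq_mul, mul_one]
  have hv : (fun j => f (Pi.single j 1)) ≠ 0 := fun h0 => hf <| LinearMap.ext fun r => by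
    rw [hfr]
    simp [fun j => congrFun h0 j]
  obtain ⟨d, hd, hm⟩ := exists_isMonicVec_mul_right hv
  refine ⟨_, hm, ?_⟩
  rw [annihilatorIdeal_mul_right _ hd]
  intro X hX
  ext i
  have hrow : X i ∈ W := fun c => by
    have : vecMulVec c (X i) = vecMulVec c (Pi.single i 1) * X := by
      ext a b
      simp [mul_apply, vecMulVec_apply, Pi.single_apply]
    rw [this]
    exact J.mul_mem_left _ hX
  exact (hfr (X i)).symm.trans (hWf hrow)

theorem annihilatorIdeal_isMaximal (hv : IsMonicVec v) : (annihilatorIdeal v).IsMaximal := by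
  refine ⟨⟨annihilatorIdeal_ne_top hv.ne_zero, fun K hK => ?_⟩⟩
  by_contra hne
  obtain ⟨w, hw, hKw⟩ := exists_le_annihilatorIdeal hne
  exact hK.not_ge (hKw.trans_eq (annihilatorIdeal_eq_of_le hv hw.ne_zero (hK.le.trans hKw)).symm)

/-- The maximal left ideals of a matrix ring over a division ring are the annihilators of
a unique monic column vector. -/
theorem bijective_annihilatorIdeal : Function.Bijective
    fun v : {v : Fin n → D // IsMonicVec v} =>
      (⟨annihilatorIdeal v.1, annihilatorIdeal_isMaximal v.2⟩ :
        {J : Ideal (Matrix (Fin n) (Fin n) D) // J.IsMaximal}) := by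
  constructor
  · rintro ⟨v, hv⟩ ⟨w, hw⟩ h
    have hle : annihilatorIdeal v ≤ annihilatorIdeal w := (Subtype.ext_iff.1 h).le
    obtain ⟨i, hi, -⟩ := id hv
    have hwv := eq_mul_right_of_annihilatorIdeal_le hi hle
    have hd : w i ≠ 0 := fun h0 => hw.ne_zero (by rw [hwv, h0]; ext; simp)
    obtain ⟨k, hk, hk'⟩ := hv.exists_common hw fun j => by
      rw [congrFun hwv j]
      simp [hd]
    have hi1 : w i = 1 := by
      have := congrFun hwv k
      rwa [hk, hk', one_mul, eq_comm] at this
    refine Subtype.ext ?_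
    change v = w
    rw [hwv]
    simp [hi1]
  · rintro ⟨J, hJ⟩
    obtain ⟨v, hv, hle⟩ := exists_le_annihilatorIdeal hJ.ne_top
    exact ⟨⟨v, hv⟩, Subtype.ext (hJ.eq_of_le (annihilatorIdeal_ne_top hv.ne_zero) hle).symm⟩

end Matrix

/-- A surjective ring homomorphism whose kernel lies in every maximal left ideal induces
a bijection on maximal left ideals. -/
theorem bijective_comap_isMaximal {A B : Type*} [Ring A] [Ring B] (f : A →+* B)
    (hf : Function.Surjective f) (hker : ∀ J : Ideal A, J.IsMaximal → RingHom.ker f ≤ J) :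
    Function.Bijective fun J : {J : Ideal B // J.IsMaximal} =>
      (⟨J.1.comap f, have := J.2; Ideal.comap_isMaximal_of_surjective f hf⟩ :
        {J : Ideal A // J.IsMaximal}) := by
  constructor
  · intro J K h
    exact Subtype.ext (Ideal.comap_injective_of_surjective f hf (Subtype.ext_iff.1 h))
  · rintro ⟨J, hJ⟩
    have hcomap : (J.map f).comap f = J := by
      rw [Ideal.comap_map_of_surjective f hf]
      exact sup_eq_left.2 (hker J hJ)
    refine ⟨⟨J.map f, (Ideal.map_eq_top_or_isMaximal_of_surjective f hf hJ).resolve_left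
      fun h => hJ.ne_top ?_⟩, Subtype.ext hcomap⟩
    rw [← hcomap, h, Ideal.comap_top]

/-- If Nakayama's lemma holds for `(A, I)`, then `I` lies in every maximal left ideal. -/
theorem mem_of_isMaximal_of_nakayama.{u} {A : Type u} [Ring A] {I : TwoSidedIdeal A}
    (hNAK : ∀ (M : Type u) [AddCommGroup M] [Module A M], Module.Finite A M →
      idealSmulSpan I M = ⊤ → Subsingleton M)
    {J : Ideal A} (hJ : J.IsMaximal) {a : A} (ha : a ∈ I) : a ∈ J := by
  have hs : IsSimpleModule A (A ⧸ J) := isSimpleModule_iff_isCoatom.2 hJ.out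
  have hbot : idealSmulSpan I (A ⧸ J) = ⊥ := (eq_bot_or_eq_top _).resolve_right fun h =>
    not_subsingleton_iff_nontrivial.2 (IsSimpleModule.nontrivial A (A ⧸ J))
      (hNAK (A ⧸ J) inferInstance h)
  have hmem : Submodule.Quotient.mk a ∈ idealSmulSpan I (A ⧸ J) :=
    Submodule.subset_span ⟨a, ha, Submodule.Quotient.mk 1, by
      rw [← Submodule.Quotient.mk_smul, smul_eq_mul, mul_one]⟩
  rw [hbot, Submodule.mem_bot] at hmem
  exact (Submodule.Quotient.mk_eq_zero J).1 hmem

/-- Let `(A, m)` be a quasi local ring (demi local, Nakayama's lemma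
holds for `(A, m)`, and `A/m` is simple Artinian) which is finite over a central subring
`R`, and suppose `A/m ≅ M_{k₀}(D)` for a division ring `D`.  Then the maximal left
ideals of `A` are in bijection with the points of the projective space `ℙ^{k₀-1}(D)`,
i.e. with the one-dimensional `D`-subspaces of `D^{k₀}`. -/
theorem quasiLocal_maximalLeftIdeals_equiv_proj.{u, v} {A : Type u} [Ring A]
    (m : TwoSidedIdeal A)
    (hmax : IsCoatom m) (huniq : ∀ m' : TwoSidedIdeal A, IsCoatom m' → m' = m)
    (hNAK : ∀ (M : Type u) [AddCommGroup M] [Module A M], Module.Finite A M →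
      idealSmulSpan m M = ⊤ → Subsingleton M)
    (hSA : IsSimpleRing m.ringCon.Quotient ∧ IsArtinianRing m.ringCon.Quotient)
    (R : Subring A) (hcent : ∀ r ∈ R, ∀ a : A, r * a = a * r)
    [Module.Finite R A]
    (k₀ : ℕ) (D : Type v) [DivisionRing D]
    (e : m.ringCon.Quotient ≃+* Matrix (Fin k₀) (Fin k₀) D) :
    Nonempty ({J : Ideal A // J.IsMaximal} ≃ Projectivization D (Fin k₀ → D)) := by
  let f : A →+* Matrix (Fin k₀) (Fin k₀) D := (e : _ →+* _).comp m.ringCon.mk'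
  have hf : Function.Surjective f := e.surjective.comp m.ringCon.mk'_surjective
  have hker (J : Ideal A) (hJ : J.IsMaximal) : RingHom.ker f ≤ J := fun a ha => by
    refine mem_of_isMaximal_of_nakayama hNAK hJ ?_
    have h0 : m.ringCon.mk' a = m.ringCon.mk' 0 := e.injective (by simpa [f] using ha)
    exact (TwoSidedIdeal.mem_iff _ _).2 ((RingCon.eq _).1 h0)
  exact ⟨(Equiv.ofBijective _ (bijective_comap_isMaximal f hf hker)).symm.trans <|
    (Equiv.ofBijective _ Matrix.bijective_annihilatorIdeal).symm.trans <|
      Equiv.ofBijective _ bijective_mk_isMonicVec⟩
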